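/- A real number x is singular if and only if x is rational. Here x ∈ ℝ is singular if for every c > 0 there exists T₀ such that for all T ≥ T₀ there exist integers p and q with 0 < |q| ≤ T and |q x + p| < c/T. -/

import Mathlib

/-- Two integer pairs approximating `x` well at the consecutive scales `T` and `T + 1` are
proportional. -/
lemma mul_eq_mul_of_abs_lt_div {x T : ℝ} (hT : 1 ≤ T) {p q p' q' : ℤ}
    (hq : |(q : ℝ)| ≤ T) (hq' : |(q' : ℝ)| ≤ T + 1)
    (h : |(q : ℝ) * x + p| < 1 / 3 / T) (h' : |(q' : ℝ) * x + p'| < 1 / 3 / (T + 1)) :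
    q * p' = q' * p := by
  have hT0 : 0 < T := by linarith
  have h₁ : |(q : ℝ)| * |(q' : ℝ) * x + p'| < 1 / 3 := by
    rw [lt_div_iff₀ (by linarith)] at h'
    nlinarith [abs_nonneg ((q' : ℝ) * x + p')]
  have h₂ : |(q' : ℝ)| * |(q : ℝ) * x + p| < 2 / 3 := by
    rw [lt_div_iff₀ hT0] at h
    nlinarith [abs_nonneg ((q : ℝ) * x + p)]
  have key : |((q * p' - q' * p : ℤ) : ℝ)| < 1 := by
    have e : ((q * p' - q' * p : ℤ) : ℝ) = q * (q' * x + p') - q' * (q * x + p) := by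
      push_cast; ring
    rw [e]
    refine (abs_sub _ _).trans_lt ?_
    rw [abs_mul, abs_mul]
    linarith
  rw [← Int.cast_abs] at key
  have := Int.abs_lt_one_iff.mp (by exact_mod_cast key)
  linarith

/-- A real number is singular if and only if it is rational (Khintchine). -/
theorem singular_iff_rational (x : ℝ) :
    (∀ c : ℝ, 0 < c → ∃ T₀ : ℝ, ∀ T : ℝ, T₀ ≤ T →
      ∃ p q : ℤ, 0 < |q| ∧ (|q| : ℝ) ≤ T ∧ |(q : ℝ) * x + (p : ℝ)| < c / T) ↔
    ∃ r : ℚ, x = (r : ℝ) := by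
  constructor
  · intro h
    obtain ⟨T₀, hT₀⟩ := h (1 / 3) (by norm_num)
    obtain ⟨M, hM₁, hM⟩ : ∃ M : ℝ, 1 ≤ M ∧ T₀ ≤ M :=
      ⟨max 1 T₀, le_max_left _ _, le_max_right _ _⟩
    have hM' (n : ℕ) : M ≤ M + n := le_add_of_nonneg_right n.cast_nonneg
    choose p q hq hqT hpq using fun n : ℕ ↦ hT₀ (M + n) (hM.trans (hM' n))
    have hq0 (n : ℕ) : q n ≠ 0 := abs_pos.mp (hq n)
    have hprop (n : ℕ) : q n * p 0 = q 0 * p n := by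
      induction n with
      | zero => rfl
      | succ n ih =>
        have hT := hqT (n + 1)
        have hp := hpq (n + 1)
        rw [Nat.cast_succ, ← add_assoc] at hT hp
        have hdet := mul_eq_mul_of_abs_lt_div (hM₁.trans (hM' n)) (hqT n) hT (hpq n) hp
        apply mul_left_cancel₀ (hq0 n)
        linear_combination q (n + 1) * ih - q 0 * hdet
    have hzero : (q 0 : ℝ) * x + p 0 = 0 := by
      by_contra hne
      have hpos := abs_pos.mpr hne
      obtain ⟨n, hn⟩ := exists_nat_gt (|(q 0 : ℝ)| / |(q 0 : ℝ) * x + p 0|)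
      rw [div_lt_iff₀ hpos] at hn
      have hprop' : (q n : ℝ) * p 0 = q 0 * p n := by exact_mod_cast hprop n
      have heq : |(q n : ℝ)| * |(q 0 : ℝ) * x + p 0| = |(q 0 : ℝ)| * |(q n : ℝ) * x + p n| := by
        rw [← abs_mul, ← abs_mul]
        congr 1
        linear_combination hprop'
      have hqn : (1 : ℝ) ≤ |(q n : ℝ)| := by exact_mod_cast hq n
      have hlt := hpq n
      rw [lt_div_iff₀ (by linarith [hM' n])] at hlt
      have h₁ : |(q 0 : ℝ) * x + p 0| ≤ |(q 0 : ℝ)| * |(q n : ℝ) * x + p n| := by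
        rw [← heq]; exact le_mul_of_one_le_left hpos.le hqn
      have h₂ : |(q 0 : ℝ) * x + p 0| * (M + n) ≤ |(q 0 : ℝ)| * (1 / 3) :=
        calc _ ≤ |(q 0 : ℝ)| * |(q n : ℝ) * x + p n| * (M + n) := by gcongr
          _ = |(q 0 : ℝ)| * (|(q n : ℝ) * x + p n| * (M + n)) := mul_assoc _ _ _
          _ ≤ _ := by gcongr
      nlinarith [abs_nonneg (q 0 : ℝ)]
    refine ⟨-p 0 / q 0, ?_⟩
    have : (q 0 : ℝ) ≠ 0 := by exact_mod_cast hq0 0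
    push_cast
    rw [eq_div_iff this]
    linarith
  · rintro ⟨r, rfl⟩ c hc
    have hden : (0 : ℝ) < r.den := by exact_mod_cast r.pos
    refine ⟨r.den, fun T hT ↦ ⟨-r.num, r.den, ?_, ?_, ?_⟩⟩
    · simpa using r.pos
    · simpa using hT
    · have e : (r.den : ℝ) * r = r.num := by exact_mod_cast r.den_mul_eq_num
      have hT0 : 0 < c / T := div_pos hc (hden.trans_le hT)
      simpa [e] using hT0
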